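/- arXiv:2105.02722 — 2 statements merged into one kernel-verified Lean document; each statement's English description precedes it below -/
import Mathlib

section
/- Let G=(V,E) be a finite simple connected graph and let X be the set of its articulation vertices. Then there exists a mutual-visibility set P of G of maximum cardinality (|P| = μ(G)) with X ∩ P = ∅. -/
open SimpleGraph

attribute [local instance] Classical.propDecidable

/-- Two vertices `u`, `v` of a set of points `P` are mutually visible in `G` if there is a
shortest `u,v`-path (a walk whose length equals the distance `G.dist u v`) none of whose
internal vertices lies in `P`. -/
def SimpleGraph.MutuallyVisible {V : Type*} (G : SimpleGraph V) (P : Set V) (u v : V) : Prop :=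
  ∃ p : G.Walk u v, p.length = G.dist u v ∧ ∀ w ∈ p.support.tail.dropLast, w ∉ P

/-- `P` is a mutual-visibility set of `G` if every two distinct points of `P`
are mutually visible. -/
def SimpleGraph.IsMVSet {V : Type*} (G : SimpleGraph V) (P : Set V) : Prop :=
  ∀ u ∈ P, ∀ v ∈ P, u ≠ v → G.MutuallyVisible P u v

/-- The mutual-visibility number `μ(G)`: the maximum cardinality of a
mutual-visibility set of `G`. -/
noncomputable def SimpleGraph.mutualVisibilityNumber {V : Type*} [Fintype V]
    (G : SimpleGraph V) : ℕ :=
  sSup {n | ∃ P : Set V, G.IsMVSet P ∧ P.ncard = n}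

/-- A vertex set `S` is convex in `G` if every shortest path in `G` between two vertices of `S`
has all of its vertices in `S`. -/
def SimpleGraph.IsConvexSet {V : Type*} (G : SimpleGraph V) (S : Set V) : Prop :=
  ∀ u ∈ S, ∀ v ∈ S, ∀ p : G.Walk u v, p.length = G.dist u v → ∀ w ∈ p.support, w ∈ S

/-- The convex hull of a set `A` of vertices: the smallest convex set containing `A`. -/
def SimpleGraph.convexHullSet {V : Type*} (G : SimpleGraph V) (A : Set V) : Set V :=
  ⋂₀ {S : Set V | G.IsConvexSet S ∧ A ⊆ S}

/-- `x` is an articulation vertex of `G` if deleting `x` increases the number of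
connected components. -/
def SimpleGraph.IsArticulation {V : Type*} (G : SimpleGraph V) (x : V) : Prop :=
  Nat.card G.ConnectedComponent < Nat.card (G.induce {x}ᶜ).ConnectedComponent

/-- `G` is a block graph if every 2-connected induced subgraph (an induced subgraph on at
least 3 vertices that is connected and remains connected after deleting any one vertex)
is complete. -/
def SimpleGraph.IsBlockGraph {V : Type*} (G : SimpleGraph V) : Prop :=
  ∀ S : Set V, 3 ≤ S.ncard → (G.induce S).Connected →
    (∀ x ∈ S, (G.induce (S \ {x})).Connected) →
    ∀ u ∈ S, ∀ v ∈ S, u ≠ v → G.Adj u v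

/-- The join of two graphs: their disjoint union together with all edges between the
two vertex sets. -/
def SimpleGraph.joinGraph {V₁ V₂ : Type*} (G₁ : SimpleGraph V₁) (G₂ : SimpleGraph V₂) :
    SimpleGraph (V₁ ⊕ V₂) :=
  (G₁ ⊕g G₂) ⊔ completeBipartiteGraph V₁ V₂

namespace SimpleGraph

variable {V : Type*} {G : SimpleGraph V}

lemma Walk.dist_add_dist_of_mem_support {u v w : V} (p : G.Walk u v)
    (hp : p.length = G.dist u v) (hw : w ∈ p.support) :
    (p.takeUntil w hw).length = G.dist u w ∧ G.dist u w + G.dist w v = G.dist u v := by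
  have h₁ := dist_le (p.takeUntil w hw)
  have h₂ := dist_le (p.dropUntil w hw)
  have h₃ := congrArg Walk.length (p.take_spec hw)
  rw [Walk.length_append] at h₃
  obtain ⟨q, hq⟩ := (p.takeUntil w hw).reachable.exists_walk_length_eq_dist
  have h₄ := dist_le (q.append (p.dropUntil w hw))
  obtain ⟨r, hr⟩ := (p.dropUntil w hw).reachable.exists_walk_length_eq_dist
  have h₅ := dist_le (q.append r)
  rw [Walk.length_append] at h₄ h₅
  omega

lemma Walk.IsPath.mem_support_tail_dropLast {u v w : V} {p : G.Walk u v} (hp : p.IsPath)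
    (huv : u ≠ v) : w ∈ p.support.tail.dropLast ↔ w ∈ p.support ∧ w ≠ u ∧ w ≠ v := by
  have hnil : ¬ p.Nil := Walk.not_nil_of_ne huv
  have hne : p.support.tail ≠ [] := fun h => by
    have hlen := congrArg List.length h
    rw [List.length_tail, p.length_support, Nat.add_sub_cancel, List.length_nil] at hlen
    exact hnil (Walk.length_eq_zero_iff.1 hlen)
  have hlast : p.support.tail.getLast hne = v := by
    rw [List.getLast_tail, Walk.getLast_support]
  have hnodup := hp.support_nodup
  have hsplit : p.support = u :: (p.support.tail.dropLast ++ [v]) := by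
    conv_lhs => rw [← p.cons_tail_support, ← List.dropLast_append_getLast hne, hlast]
  generalize p.support.tail.dropLast = l at *
  rw [hsplit] at hnodup ⊢
  simp only [List.nodup_cons, List.mem_append, List.nodup_append, List.mem_cons] at hnodup ⊢
  grind

lemma mutuallyVisible_iff {P : Set V} {u v : V} (huv : u ≠ v) :
    G.MutuallyVisible P u v ↔ ∃ p : G.Walk u v, p.length = G.dist u v ∧
      ∀ w ∈ p.support, w ≠ u → w ≠ v → w ∉ P := by
  refine exists_congr fun p => and_congr_right fun hp => forall_congr' fun w => ?_
  rw [(p.isPath_of_length_eq_dist hp).mem_support_tail_dropLast huv]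
  tauto

lemma MutuallyVisible.symm {P : Set V} {u v : V} (huv : u ≠ v) (h : G.MutuallyVisible P u v) :
    G.MutuallyVisible P v u := by
  rw [mutuallyVisible_iff huv] at h
  obtain ⟨p, hp, h⟩ := h
  refine (mutuallyVisible_iff huv.symm).2 ⟨p.reverse, by rw [p.length_reverse, hp, dist_comm], ?_⟩
  intro w hw hv hu
  exact h w (by simpa using hw) hu hv

/-- `u` and `v` are joined by a walk that misses `x`. -/
def JoinedAvoiding (G : SimpleGraph V) (x u v : V) : Prop :=
  ∃ p : G.Walk u v, x ∉ p.support

lemma JoinedAvoiding.symm {x u v : V} (h : G.JoinedAvoiding x u v) : G.JoinedAvoiding x v u := by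
  obtain ⟨p, hp⟩ := h
  exact ⟨p.reverse, by simpa using hp⟩

lemma JoinedAvoiding.trans {x u v w : V} (h : G.JoinedAvoiding x u v)
    (h' : G.JoinedAvoiding x v w) : G.JoinedAvoiding x u w := by
  obtain ⟨p, hp⟩ := h
  obtain ⟨q, hq⟩ := h'
  exact ⟨p.append q, by simp [Walk.mem_support_append_iff, hp, hq]⟩

lemma JoinedAvoiding.ne_right {x u v : V} (h : G.JoinedAvoiding x u v) : v ≠ x := by
  obtain ⟨p, hp⟩ := h
  rintro rfl
  exact hp p.end_mem_support

lemma Connected.isArticulation_iff [Finite V] (hG : G.Connected) (x : V) :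
    G.IsArticulation x ↔ ∃ a b, a ≠ x ∧ b ≠ x ∧ ¬ G.JoinedAvoiding x a b := by
  have hcard : Nat.card G.ConnectedComponent = 1 := by
    have := hG.preconnected.subsingleton_connectedComponent
    have := hG.nonempty
    exact Nat.card_unique
  rw [IsArticulation, hcard, Finite.one_lt_card_iff_nontrivial, ← not_iff_not,
    not_nontrivial_iff_subsingleton]
  push Not
  constructor
  · intro h a b (ha : a ∈ ({x}ᶜ : Set V)) (hb : b ∈ ({x}ᶜ : Set V))
    obtain ⟨p⟩ := ConnectedComponent.exact (h.elim
      ((G.induce {x}ᶜ).connectedComponentMk ⟨a, ha⟩) ((G.induce {x}ᶜ).connectedComponentMk ⟨b, hb⟩))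
    have hp : x ∉ (p.map (Embedding.induce _).toHom).support := by
      rw [Walk.support_map, List.mem_map]
      rintro ⟨⟨w, hw⟩, -, hwx⟩
      exact hw hwx
    exact ⟨_, hp⟩
  · intro h
    refine Preconnected.subsingleton_connectedComponent fun a b => ?_
    obtain ⟨p, hp⟩ := h a b a.2 b.2
    exact ⟨p.induce {x}ᶜ fun w hw hwx => hp (hwx ▸ hw)⟩

/-- A vertex farthest from `x` within its component of `G - x` is not an articulation vertex. -/
lemma Connected.not_isArticulation_of_farthest [Finite V] (hG : G.Connected) {x y : V}
    (hyx : y ≠ x) (hmax : ∀ z, G.JoinedAvoiding x z y → G.dist z x ≤ G.dist y x) :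
    ¬ G.IsArticulation y := by
  have key : ∀ z, z ≠ y → G.JoinedAvoiding y z x := by
    intro z hz
    obtain ⟨p, hp⟩ := hG.exists_walk_length_eq_dist z x
    refine ⟨p, fun hy => ?_⟩
    have hzy := hG.pos_dist_of_ne hz
    have hxy := hG.pos_dist_of_ne hyx
    obtain ⟨htake, hadd⟩ := p.dist_add_dist_of_mem_support hp hy
    by_cases hjoin : G.JoinedAvoiding x z y
    · have := hmax z hjoin
      omega
    · have hx : x ∈ (p.takeUntil y hy).support := by
        by_contra hx
        exact hjoin ⟨_, hx⟩
      have := (Walk.dist_add_dist_of_mem_support _ htake hx).2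
      omega
  rw [hG.isArticulation_iff]
  rintro ⟨a, b, ha, hb, hab⟩
  exact hab ((key a ha).trans (key b hb).symm)

lemma IsMVSet.joinedAvoiding {P : Set V} (hP : G.IsMVSet P) {x a b : V} (hx : x ∈ P)
    (ha : a ∈ P) (hb : b ∈ P) (hax : a ≠ x) (hbx : b ≠ x) : G.JoinedAvoiding x a b := by
  by_cases hab : a = b
  · subst hab
    exact ⟨Walk.nil, by simpa using hax.symm⟩
  · obtain ⟨p, -, h⟩ := (mutuallyVisible_iff hab).1 (hP a ha b hb hab)
    exact ⟨p, fun hxp => h x hxp hax.symm hbx.symm hx⟩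

/-- In a mutual-visibility set, `x` may be exchanged for a vertex `y` that `x` separates from the
remaining points. -/
lemma IsMVSet.exchange (hG : G.Connected) {P : Set V} (hP : G.IsMVSet P) {x y : V} (hx : x ∈ P)
    (hyx : y ≠ x) (hsep : ∀ a ∈ P, a ≠ x → ¬ G.JoinedAvoiding x a y) :
    G.IsMVSet (insert y (P \ {x})) := by
  have hnew : ∀ a ∈ P, a ≠ x → a ≠ y → G.MutuallyVisible (insert y (P \ {x})) a y := by
    intro a ha hax hay
    obtain ⟨p, hp, hvis⟩ := (mutuallyVisible_iff hax).1 (hP a ha x hx hax)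
    obtain ⟨q, hq⟩ := hG.exists_walk_length_eq_dist x y
    obtain ⟨r, hr⟩ := hG.exists_walk_length_eq_dist a y
    have hxr : x ∈ r.support := by
      by_contra h
      exact hsep a ha hax ⟨r, h⟩
    have hadd := (r.dist_add_dist_of_mem_support hr hxr).2
    refine (mutuallyVisible_iff hay).2 ⟨p.append q, by rw [Walk.length_append, hp, hq, hadd], ?_⟩
    rintro w hw hwa hwy (rfl | ⟨hwP, hwx⟩)
    · exact hwy rfl
    rw [Walk.mem_support_append_iff] at hw
    rcases hw with hw | hw
    · exact hvis w hw hwa hwx hwP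
    · obtain ⟨htake, hadd'⟩ := q.dist_add_dist_of_mem_support hq hw
      obtain ⟨s, hs⟩ := hG.exists_walk_length_eq_dist w y
      refine hsep w hwP hwx ⟨s, fun hxs => hwx ?_⟩
      have hadd'' := (s.dist_add_dist_of_mem_support hs hxs).2
      have : G.dist x w = 0 := by omega
      exact (hG.dist_eq_zero_iff.1 this).symm
  rintro a (rfl | ⟨ha, hax⟩) b (rfl | ⟨hb, hbx⟩) hab
  · exact absurd rfl hab
  · exact (hnew b hb hbx hab.symm).symm hab.symm
  · exact hnew a ha hax hab
  · obtain ⟨p, hp, hvis⟩ := (mutuallyVisible_iff hab).1 (hP a ha b hb hab)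
    refine (mutuallyVisible_iff hab).2 ⟨p, hp, ?_⟩
    rintro w hw hwa hwb (rfl | ⟨hwP, -⟩)
    · refine hsep a ha hax ⟨p.takeUntil w hw, fun h => ?_⟩
      exact hvis x (p.support_takeUntil_subset_support hw h) (Ne.symm hax) (Ne.symm hbx) hx
    · exact hvis w hw hwa hwb hwP

lemma IsMVSet.exists_exchange_articulation [Finite V] (hG : G.Connected) {P : Set V}
    (hP : G.IsMVSet P) {x : V} (hx : x ∈ P) (hart : G.IsArticulation x) :
    ∃ y ∉ P, ¬ G.IsArticulation y ∧ G.IsMVSet (insert y (P \ {x})) := by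
  obtain ⟨a, b, ha, hb, hab⟩ := (hG.isArticulation_iff x).1 hart
  obtain ⟨c, hcx, hc⟩ : ∃ c ≠ x, ∀ p ∈ P, p ≠ x → ¬ G.JoinedAvoiding x p c := by
    by_cases h : ∃ p ∈ P, p ≠ x ∧ G.JoinedAvoiding x p a
    · obtain ⟨p, hp, hpx, hpa⟩ := h
      refine ⟨b, hb, fun q hq hqx hqb => hab ?_⟩
      exact hpa.symm.trans ((hP.joinedAvoiding hx hp hq hpx hqx).trans hqb)
    · exact ⟨a, ha, fun p hp hpx hpa => h ⟨p, hp, hpx, hpa⟩⟩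
  obtain ⟨y, hy, hmax⟩ := Set.exists_max_image {v | G.JoinedAvoiding x c v} (fun v => G.dist v x)
    (Set.toFinite _) ⟨c, Walk.nil, by simpa using hcx.symm⟩
  have hsep : ∀ p ∈ P, p ≠ x → ¬ G.JoinedAvoiding x p y :=
    fun p hp hpx hpy => hc p hp hpx (hpy.trans (JoinedAvoiding.symm hy))
  have hyx : y ≠ x := JoinedAvoiding.ne_right hy
  refine ⟨y, fun hyP => hsep y hyP hyx ⟨Walk.nil, by simpa using hyx.symm⟩, ?_,
    hP.exchange hG hx hyx hsep⟩
  exact hG.not_isArticulation_of_farthest hyx fun z hz => hmax z (JoinedAvoiding.trans hy hz.symm)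

lemma exists_isMVSet_ncard_eq_mutualVisibilityNumber [Fintype V] (G : SimpleGraph V) :
    ∃ P : Set V, G.IsMVSet P ∧ P.ncard = G.mutualVisibilityNumber := by
  refine Nat.sSup_mem (s := {n | ∃ P : Set V, G.IsMVSet P ∧ P.ncard = n})
    ⟨0, ∅, by simp [IsMVSet], Set.ncard_empty V⟩ ⟨Nat.card V, ?_⟩
  rintro n ⟨P, -, rfl⟩
  exact Set.ncard_le_card P

end SimpleGraph

theorem exists_max_mvSet_avoiding_articulations {V : Type*} [Fintype V]
    (G : SimpleGraph V) (hG : G.Connected) :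
    ∃ P : Set V, G.IsMVSet P ∧ P.ncard = G.mutualVisibilityNumber ∧
      ∀ x : V, G.IsArticulation x → x ∉ P := by
  obtain ⟨P, ⟨hP, hcard⟩, hmin⟩ := Set.exists_min_image
    {P : Set V | G.IsMVSet P ∧ P.ncard = G.mutualVisibilityNumber}
    (fun P => (P ∩ {x | G.IsArticulation x}).ncard) (Set.toFinite _)
    G.exists_isMVSet_ncard_eq_mutualVisibilityNumber
  refine ⟨P, hP, hcard, fun x hart hx => ?_⟩
  obtain ⟨y, hyP, hy, hmv⟩ := hP.exists_exchange_articulation hG hx hart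
  refine (hmin (insert y (P \ {x})) ⟨hmv, by rw [Set.ncard_exchange hyP hx, hcard]⟩).not_gt
    (Set.ncard_lt_ncard (Set.ssubset_iff_of_subset ?_ |>.2 ⟨x, ⟨hx, hart⟩, ?_⟩))
  · rintro w ⟨rfl | ⟨hw, -⟩, hwart⟩
    · exact absurd hwart hy
    · exact ⟨hw, hwart⟩
  · rintro ⟨rfl | ⟨-, hxx⟩, -⟩
    · exact hyP hx
    · exact hxx rfl
end

section
/- Let G=(V,E) be a finite simple connected graph with |V| > 2. Then μ(G) = |E| if and only if G is a star K_{1,|V|−1} (i.e., there is a vertex adjacent to all other vertices and E consists exactly of these edges) or G is a triangle (the complete graph on 3 vertices). -/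
open SimpleGraph

attribute [local instance] Classical.propDecidable

namespace SimpleGraph

variable {V : Type*} {G : SimpleGraph V}

theorem MutuallyVisible.of_adj {P : Set V} {u v : V} (h : G.Adj u v) :
    G.MutuallyVisible P u v :=
  ⟨h.toWalk, by simp [dist_eq_one_iff_adj.2 h], by simp⟩

theorem MutuallyVisible.adj_or_exists_adj {P : Set V} {u v : V} (huv : u ≠ v)
    (h : G.MutuallyVisible P u v) :
    G.Adj u v ∨ ∃ z ∉ P, G.Adj u z ∧ (G.Adj z v ∨ ∃ y ∉ P, G.Adj z y) := by
  obtain ⟨p, -, hp⟩ := h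
  cases p with
  | nil => exact absurd rfl huv
  | cons h₁ q =>
    cases q with
    | nil => exact .inl h₁
    | cons h₂ r =>
      cases r with
      | nil => exact .inr ⟨_, hp _ (by simp), h₁, .inl h₂⟩
      | cons h₃ t =>
        have hne : t.support ≠ [] := t.support_ne_nil
        exact .inr ⟨_, hp _ (by simp [List.dropLast_cons_of_ne_nil, hne]), h₁,
          .inr ⟨_, hp _ (by simp [List.dropLast_cons_of_ne_nil, hne]), h₂⟩⟩

theorem IsMVSet.adj_of_univ (h : G.IsMVSet Set.univ) {u v : V} (huv : u ≠ v) : G.Adj u v := by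
  simpa using (h u trivial v trivial huv).adj_or_exists_adj huv

theorem IsMVSet.adj_or_of_compl_singleton {x : V} (h : G.IsMVSet {x}ᶜ) {u v : V}
    (hu : u ≠ x) (hv : v ≠ x) (huv : u ≠ v) : G.Adj u v ∨ G.Adj u x ∧ G.Adj x v := by
  simpa using (h u hu v hv huv).adj_or_exists_adj huv

theorem ncard_image_mk (v : V) (s : Set V) : ((fun w => s(v, w)) '' s).ncard = s.ncard :=
  Set.ncard_image_of_injective s fun _ _ => Sym2.congr_right.1

theorem mk_mem_image_mk_compl_singleton {u v w : V} :
    s(u, w) ∈ (fun w => s(v, w)) '' {v}ᶜ ↔ ((u = v ∧ w ≠ v) ∨ (w = v ∧ u ≠ v)) := by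
  constructor
  · rintro ⟨x, hx, hxe⟩
    rcases Sym2.eq_iff.1 hxe with ⟨rfl, rfl⟩ | ⟨rfl, rfl⟩
    · exact .inl ⟨rfl, hx⟩
    · exact .inr ⟨rfl, hx⟩
  · rintro (⟨rfl, hw⟩ | ⟨rfl, hu⟩)
    · exact ⟨w, hw, rfl⟩
    · exact ⟨u, hu, Sym2.eq_swap⟩

variable [Fintype V]

theorem bddAbove_ncard_isMVSet : BddAbove {n | ∃ P : Set V, G.IsMVSet P ∧ P.ncard = n} := by
  refine ⟨Nat.card V, ?_⟩
  rintro _ ⟨P, -, rfl⟩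
  exact Set.ncard_le_card P

theorem IsMVSet.ncard_le {P : Set V} (h : G.IsMVSet P) :
    P.ncard ≤ G.mutualVisibilityNumber :=
  le_csSup (bddAbove_ncard_isMVSet (G := G)) ⟨P, h, rfl⟩

theorem exists_isMVSet_ncard_eq (G : SimpleGraph V) :
    ∃ P : Set V, G.IsMVSet P ∧ P.ncard = G.mutualVisibilityNumber :=
  Nat.sSup_mem (s := {n | ∃ P : Set V, G.IsMVSet P ∧ P.ncard = n})
    ⟨0, ∅, by simp [IsMVSet], by simp⟩ bddAbove_ncard_isMVSet

theorem mutualVisibilityNumber_le_card (G : SimpleGraph V) :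
    G.mutualVisibilityNumber ≤ Fintype.card V := by
  obtain ⟨P, -, hP⟩ := G.exists_isMVSet_ncard_eq
  rw [← hP, ← Nat.card_eq_fintype_card]
  exact Set.ncard_le_card P

theorem mutualVisibilityNumber_eq_card_iff :
    G.mutualVisibilityNumber = Fintype.card V ↔ ∀ u v, u ≠ v → G.Adj u v := by
  constructor
  · intro h u v huv
    obtain ⟨P, hP, hcard⟩ := G.exists_isMVSet_ncard_eq
    have : P = Set.univ := by
      rw [Set.eq_univ_iff_ncard, hcard, h, Nat.card_eq_fintype_card]
    subst this
    exact hP.adj_of_univ huv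
  · intro h
    refine le_antisymm G.mutualVisibilityNumber_le_card ?_
    have hP : G.IsMVSet Set.univ := fun u _ v _ huv => .of_adj (h u v huv)
    simpa [Set.ncard_univ] using hP.ncard_le

theorem ncard_edgeSet_of_forall_adj (h : ∀ u v, u ≠ v → G.Adj u v) :
    G.edgeSet.ncard = (Fintype.card V).choose 2 := by
  have hG : G = ⊤ := by
    ext u v
    exact ⟨fun h => h.ne, h u v⟩
  subst hG
  rw [← card_edgeFinset_top_eq_card_choose_two, ← coe_edgeFinset, Set.ncard_coe_finset]

theorem ncard_compl_singleton (v : V) : ({v}ᶜ : Set V).ncard = Fintype.card V - 1 := by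
  rw [Set.ncard_compl, Set.ncard_singleton, Nat.card_eq_fintype_card]

theorem ncard_edgeSet_of_star {v : V}
    (h : ∀ u w, G.Adj u w ↔ ((u = v ∧ w ≠ v) ∨ (w = v ∧ u ≠ v))) :
    G.edgeSet.ncard = Fintype.card V - 1 := by
  have : G.edgeSet = (fun w => s(v, w)) '' {v}ᶜ := by
    ext e
    induction e with | _ a b =>
    rw [mem_edgeSet, h, mk_mem_image_mk_compl_singleton]
  rw [this, ncard_image_mk, ncard_compl_singleton]

theorem star_of_forall_adj {v : V} (hv : ∀ w, w ≠ v → G.Adj v w)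
    (hE : G.edgeSet.ncard = Fintype.card V - 1) (u w : V) :
    G.Adj u w ↔ ((u = v ∧ w ≠ v) ∨ (w = v ∧ u ≠ v)) := by
  have hsub : (fun w => s(v, w)) '' {v}ᶜ ⊆ G.edgeSet := by
    rintro _ ⟨w, hw, rfl⟩
    exact hv w hw
  have heq := Set.eq_of_subset_of_ncard_le hsub
    (by rw [ncard_image_mk, ncard_compl_singleton, hE]) (Set.toFinite _)
  rw [← mem_edgeSet, ← heq, mk_mem_image_mk_compl_singleton]

theorem IsMVSet.exists_forall_adj {x : V} (h : G.IsMVSet {x}ᶜ) (hconn : G.Connected)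
    (hcard : 2 < Fintype.card V) (hE : G.edgeSet.ncard = Fintype.card V - 1) :
    ∃ v, ∀ w, w ≠ v → G.Adj v w := by
  by_contra! hno
  obtain ⟨u, hux, hxu⟩ := hno x
  have hu : ∀ v, v ≠ x → v ≠ u → G.Adj u v := fun v hvx hvu =>
    (h.adj_or_of_compl_singleton hux hvx hvu.symm).resolve_right fun h => hxu h.1.symm
  have : Nontrivial V := ⟨u, x, hux⟩
  obtain ⟨w, hxw⟩ := hconn.preconnected.exists_adj_of_nontrivial x
  have hwu : w ≠ u := fun h => hxu (h ▸ hxw)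
  have hsub : insert s(x, w) ((fun v => s(u, v)) '' {u, x}ᶜ) ⊆ G.edgeSet := by
    rintro _ (rfl | ⟨v, hv, rfl⟩)
    · exact hxw
    · simp only [Set.mem_compl_iff, Set.mem_insert_iff, Set.mem_singleton_iff, not_or] at hv
      exact hu v hv.2 hv.1
  have hnot : s(x, w) ∉ (fun v => s(u, v)) '' {u, x}ᶜ := by
    simp
    grind
  have heq := Set.eq_of_subset_of_ncard_le hsub (by
    rw [Set.ncard_insert_of_notMem hnot, ncard_image_mk, Set.ncard_compl,
      Set.ncard_pair hux, Nat.card_eq_fintype_card, hE]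
    omega) (Set.toFinite _)
  obtain ⟨v, hvw, hwv⟩ := hno w
  have hvu : v ≠ u := fun h => hwv (h ▸ (hu w hxw.ne' hwu).symm)
  have hvx : v ≠ x := fun h => hwv (h ▸ hxw.symm)
  have hxv := ((h.adj_or_of_compl_singleton hxw.ne' hvx hvw.symm).resolve_left hwv).2
  rw [← mem_edgeSet, ← heq] at hxv
  simp at hxv
  grind

end SimpleGraph

theorem mu_eq_edge_count_iff {V : Type*} [Fintype V] (G : SimpleGraph V)
    (hconn : G.Connected) (hcard : 2 < Fintype.card V) :
    G.mutualVisibilityNumber = G.edgeSet.ncard ↔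
      (∃ v : V, ∀ u w : V, G.Adj u w ↔ ((u = v ∧ w ≠ v) ∨ (w = v ∧ u ≠ v))) ∨
        (Fintype.card V = 3 ∧ ∀ u v : V, u ≠ v → G.Adj u v) := by
  have hle := hconn.card_vert_le_card_edgeSet_add_one
  rw [Nat.card_eq_fintype_card, Nat.card_coe_set_eq] at hle
  constructor
  · intro hmu
    by_cases hcomplete : ∀ u v, u ≠ v → G.Adj u v
    · right
      refine ⟨?_, hcomplete⟩
      have hn := mutualVisibilityNumber_eq_card_iff.2 hcomplete
      rw [hmu, ncard_edgeSet_of_forall_adj hcomplete, Nat.choose_two_right] at hn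
      have hdiv := Nat.div_mul_cancel (Nat.even_mul_pred_self (Fintype.card V)).two_dvd
      rw [hn] at hdiv
      have := Nat.eq_of_mul_eq_mul_left (by omega) hdiv
      omega
    · left
      have hne := mt mutualVisibilityNumber_eq_card_iff.1 hcomplete
      have hmu_le := G.mutualVisibilityNumber_le_card
      have hE : G.edgeSet.ncard = Fintype.card V - 1 := by omega
      obtain ⟨P, hP, hPcard⟩ := G.exists_isMVSet_ncard_eq
      have hcompl : Pᶜ.ncard = 1 := by
        rw [Set.ncard_compl, hPcard, Nat.card_eq_fintype_card]
        omega
      obtain ⟨x, hx⟩ := Set.ncard_eq_one.1 hcompl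
      rw [← compl_compl P, hx] at hP
      obtain ⟨v, hv⟩ := hP.exists_forall_adj hconn hcard hE
      exact ⟨v, star_of_forall_adj hv hE⟩
  · rintro (⟨v, hv⟩ | ⟨h3, hcomplete⟩)
    · rw [ncard_edgeSet_of_star hv]
      have hne : G.mutualVisibilityNumber ≠ Fintype.card V := by
        intro h
        obtain ⟨a, b, ha, hb, hab⟩ : ∃ a b, a ≠ v ∧ b ≠ v ∧ a ≠ b := by
          have : 1 < ({v}ᶜ : Set V).ncard := by
            rw [ncard_compl_singleton]
            omega
          obtain ⟨a, b, ha, hb, hab⟩ := (Set.one_lt_ncard_iff (Set.toFinite _)).1 this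
          exact ⟨a, b, ha, hb, hab⟩
        have := mutualVisibilityNumber_eq_card_iff.1 h a b hab
        simp [hv, ha, hb] at this
      have hP : G.IsMVSet {v}ᶜ := by
        intro a ha b hb hab
        have hav : G.Adj a v := (hv a v).2 (.inr ⟨rfl, ha⟩)
        have hvb : G.Adj v b := (hv v b).2 (.inl ⟨rfl, hb⟩)
        have hnadj : ¬ G.Adj a b := by
          rw [hv]
          exact fun h => h.elim (fun h => ha h.1) fun h => hb h.1
        refine ⟨.cons hav hvb.toWalk, ?_, by simp⟩
        have h0 := hconn.pos_dist_of_ne hab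
        have h1 := mt dist_eq_one_iff_adj.1 hnadj
        have h2 := dist_le (.cons hav hvb.toWalk)
        simp only [Walk.length_cons, Walk.length_nil] at h2 ⊢
        omega
      have h1 := hP.ncard_le
      rw [ncard_compl_singleton] at h1
      have h2 := G.mutualVisibilityNumber_le_card
      omega
    · rw [mutualVisibilityNumber_eq_card_iff.2 hcomplete,
        ncard_edgeSet_of_forall_adj hcomplete, h3]
      rfl
end
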